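/- With μ₁(λ,k) = (T(λ,k) − √(T(λ,k)² − 4D(λ,k)))/2 − 2 and μ₂(λ,k) = (T(λ,k) + √(T(λ,k)² − 4D(λ,k)))/2 − 2, the following hold. (i) For every λ ∈ (0,1): μ₁(λ,1) = −2 and μ₂(λ,1) = 0. (ii) For every λ ∈ (0,1) and every integer k ≥ 2: μ₂(λ,k) > 0. (iii) For every integer k ≥ 2 and every λ ∈ (0,1), lim_{λ→0⁺} μ₁(λ,k) = k − 1 and lim_{λ→1⁻} μ₁(λ,k) = −2, and there exists a unique λ_k ∈ (0,1) with μ₁(λ_k,k) = 0; moreover ∂μ₁/∂λ(λ_k,k) < 0. (iv) The sequence (λ_k)_{k ≥ 2} is strictly increasing and converges to 1. (v) For every λ ∈ (0,1) and i = 1,2, the limit lim_{k→+∞} μ_i(λ,k)/k exists, is finite and positive; in particular lim_{k→+∞} T(λ,k)/k = R(λ)²(1 − λ²)/λ² and lim_{k→+∞} D(λ,k)/T(λ,k)² = λ²(R(λ)² − λ²)(1 − R(λ)²)/(R(λ)⁴(1 − λ²)²). -/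

import Mathlib

open Set Filter
open scoped Topology

noncomputable section

/-- `R(λ)² = (1 - λ²)/(-2 log λ)`. -/
def Rsq (l : ℝ) : ℝ := (1 - l^2)/(-2*Real.log l)

/-- `ω(λ,k) = -k log λ`. -/
def om (l k : ℝ) : ℝ := -(k * Real.log l)

/-- The hyperbolic cotangent. -/
def cothR (x : ℝ) : ℝ := Real.cosh x / Real.sinh x

/-- `c^i_λ = R(λ)²/λ - λ`. -/
def cI (l : ℝ) : ℝ := Rsq l / l - l

/-- `c^o_λ = 1 - R(λ)²`. -/
def cO (l : ℝ) : ℝ := 1 - Rsq l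

/-- The trace `T(λ,k) = R²(1/λ² - 1) k coth ω + 2 - R² - R²/λ²` of `M̃_{λ,k}`. -/
def Tfun (l k : ℝ) : ℝ :=
  Rsq l * (1/l^2 - 1) * k * cothR (om l k) + 2 - Rsq l - Rsq l/l^2

/-- The determinant `D(λ,k) = (R²/λ² - 1)(1 - R²)(k² - 1)` of `M̃_{λ,k}`. -/
def Dfun (l k : ℝ) : ℝ := (Rsq l/l^2 - 1) * (1 - Rsq l) * (k^2 - 1)

/-- The smaller eigenvalue `μ₁(λ,k) = (T - √(T² - 4D))/2 - 2` of `M_{λ,k}`. -/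
def mu1 (l k : ℝ) : ℝ :=
  (Tfun l k - Real.sqrt ((Tfun l k)^2 - 4*Dfun l k))/2 - 2

/-- The larger eigenvalue `μ₂(λ,k) = (T + √(T² - 4D))/2 - 2` of `M_{λ,k}`. -/
def mu2 (l k : ℝ) : ℝ :=
  (Tfun l k + Real.sqrt ((Tfun l k)^2 - 4*Dfun l k))/2 - 2


lemma cothR_sq_sub_one {x : ℝ} (hx : 0 < x) : cothR x ^ 2 - 1 = 1 / Real.sinh x ^ 2 := by
  have hs := (Real.sinh_pos_iff.2 hx).ne'
  unfold cothR
  field_simp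
  linarith [Real.cosh_sq x]

lemma one_lt_cothR {x : ℝ} (hx : 0 < x) : 1 < cothR x :=
  (one_lt_div (Real.sinh_pos_iff.2 hx)).2 (Real.sinh_lt_cosh x)

lemma hasDerivAt_cothR {x : ℝ} (hx : 0 < x) : HasDerivAt cothR (1 - cothR x ^ 2) x := by
  have hs := (Real.sinh_pos_iff.2 hx).ne'
  refine ((Real.hasDerivAt_cosh x).div (Real.hasDerivAt_sinh x) hs).congr_deriv ?_
  unfold cothR
  field_simp

lemma tendsto_cothR_atTop : Tendsto cothR atTop (𝓝 1) := by
  have hE : Tendsto (fun x : ℝ => Real.exp (-x) ^ 2) atTop (𝓝 0) := by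
    simpa using (Real.tendsto_exp_neg_atTop_nhds_zero).pow 2
  have h : Tendsto (fun x : ℝ => (1 + Real.exp (-x) ^ 2) / (1 - Real.exp (-x) ^ 2)) atTop
      (𝓝 1) := by
    simpa [Pi.div_def] using (hE.const_add 1).div (hE.const_sub 1) (by norm_num)
  refine h.congr fun x => ?_
  have e : Real.exp x * Real.exp (-x) = 1 := by rw [← Real.exp_add]; simp
  have h1 : 1 + Real.exp (-x) ^ 2 = 2 * Real.exp (-x) * Real.cosh x := by
    rw [Real.cosh_eq]; linear_combination -e
  have h2 : 1 - Real.exp (-x) ^ 2 = 2 * Real.exp (-x) * Real.sinh x := by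
    rw [Real.sinh_eq]; linear_combination -e
  rw [h1, h2, mul_div_mul_left _ _ (by positivity)]
  rfl

lemma tendsto_self_mul_cothR_zero : Tendsto (fun x => x * cothR x) (𝓝[≠] 0) (𝓝 1) := by
  have h1 : Tendsto (fun x : ℝ => x⁻¹ * Real.sinh x) (𝓝[≠] 0) (𝓝 1) := by
    simpa using (Real.hasDerivAt_sinh 0).tendsto_slope_zero
  have h2 : Tendsto Real.cosh (𝓝[≠] 0) (𝓝 1) := by
    simpa using (Real.continuous_cosh.tendsto 0).mono_left nhdsWithin_le_nhds
  refine (by simpa [Pi.div_def] using h2.div h1 one_ne_zero :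
    Tendsto (fun x => Real.cosh x / (x⁻¹ * Real.sinh x)) (𝓝[≠] 0) (𝓝 1)).congr fun x => ?_
  unfold cothR
  rw [div_mul_eq_div_div, div_inv_eq_mul]
  ring

lemma self_lt_sinh {x : ℝ} (hx : 0 < x) : x < Real.sinh x := Real.self_lt_sinh_iff.2 hx

lemma hasDerivAt_self_mul_cothR {x : ℝ} (hx : 0 < x) :
    HasDerivAt (fun x => x * cothR x) (cothR x + x * (1 - cothR x ^ 2)) x := by
  simpa using (hasDerivAt_id' x).fun_mul (hasDerivAt_cothR hx)

lemma strictMonoOn_self_mul_cothR : StrictMonoOn (fun x => x * cothR x) (Ioi 0) := by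
  refine strictMonoOn_of_deriv_pos (convex_Ioi 0)
    (fun x hx => (hasDerivAt_self_mul_cothR hx).continuousAt.continuousWithinAt) fun x hx => ?_
  rw [interior_Ioi] at hx
  have hx : 0 < x := hx
  have hs := Real.sinh_pos_iff.2 hx
  rw [(hasDerivAt_self_mul_cothR hx).deriv]
  have e : cothR x + x * (1 - cothR x ^ 2) = (Real.sinh x * Real.cosh x - x) / Real.sinh x ^ 2 := by
    rw [← neg_sub (cothR x ^ 2) 1, cothR_sq_sub_one hx]
    unfold cothR
    field_simp
    ring
  rw [e]
  have := self_lt_sinh hx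
  have := Real.one_lt_cosh.2 hx.ne'
  apply div_pos _ (by positivity)
  nlinarith

/-- Comparison at the origin through derivatives. -/
lemma pos_of_deriv_pos {f f' : ℝ → ℝ} (hf : ∀ x, HasDerivAt f (f' x) x) (h0 : f 0 = 0)
    (hf' : ∀ x, 0 < x → 0 < f' x) {x : ℝ} (hx : 0 < x) : 0 < f x := by
  have h : StrictMonoOn f (Ici 0) := by
    refine strictMonoOn_of_deriv_pos (convex_Ici 0)
      (fun x _ => (hf x).continuousAt.continuousWithinAt) fun x hx => ?_
    rw [interior_Ici] at hx
    rw [(hf x).deriv]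
    exact hf' x hx
  simpa [h0] using h (by simp) hx.le hx

lemma sinh_lt_mul_cosh {x : ℝ} (hx : 0 < x) : Real.sinh x < x * Real.cosh x := by
  have := pos_of_deriv_pos (f := fun x => x * Real.cosh x - Real.sinh x)
    (f' := fun x => x * Real.sinh x)
    (fun x => by
      refine (((hasDerivAt_id x).mul (Real.hasDerivAt_cosh x)).sub
        (Real.hasDerivAt_sinh x)).congr_deriv ?_
      simp) (by simp) (fun x hx => mul_pos hx (Real.sinh_pos_iff.2 hx)) hx
  linarith

lemma cubic_lt_sinh {x : ℝ} (hx : 0 < x) : x + x ^ 3 / 6 < Real.sinh x := by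
  have h2 : ∀ x : ℝ, 0 < x → 0 < Real.cosh x - 1 - x ^ 2 / 2 := fun x hx =>
    pos_of_deriv_pos (f := fun x => Real.cosh x - 1 - x ^ 2 / 2) (f' := fun x => Real.sinh x - x)
      (fun x => by
        refine (((Real.hasDerivAt_cosh x).sub_const 1).sub
          (((hasDerivAt_id x).pow 2).div_const 2)).congr_deriv ?_
        simp) (by simp) (fun x hx => sub_pos.2 (self_lt_sinh hx)) hx
  have := pos_of_deriv_pos (f := fun x => Real.sinh x - x - x ^ 3 / 6)
    (f' := fun x => Real.cosh x - 1 - x ^ 2 / 2)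
    (fun x => by
      refine (((Real.hasDerivAt_sinh x).sub (hasDerivAt_id x)).sub
        (((hasDerivAt_id x).pow 3).div_const 6)).congr_deriv ?_
      simp; ring) (by simp) h2 hx
  linarith

lemma cubic_lt_tanh {x : ℝ} (hx : 0 < x) :
    x - x ^ 3 / 3 < Real.sinh x / Real.cosh x := by
  have hc : ∀ x, Real.cosh x ≠ 0 := fun x => (Real.cosh_pos x).ne'
  have := pos_of_deriv_pos (f := fun x => Real.sinh x / Real.cosh x - (x - x ^ 3 / 3))
    (f' := fun x => x ^ 2 - (Real.sinh x / Real.cosh x) ^ 2)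
    (fun x => by
      refine (((Real.hasDerivAt_sinh x).div (Real.hasDerivAt_cosh x) (hc x)).sub
        ((hasDerivAt_id x).sub (((hasDerivAt_id x).pow 3).div_const 3))).congr_deriv ?_
      have := hc x
      simp
      field_simp
      ring) (by simp)
    (fun x hx => by
      have h := (div_lt_iff₀ (Real.cosh_pos x)).2 (sinh_lt_mul_cosh hx)
      have h' := div_pos (Real.sinh_pos_iff.2 hx) (Real.cosh_pos x)
      nlinarith) hx
  linarith

/-- The hyperbolic Wilker inequality, cleared of denominators. -/
lemma wilker_sinh {x : ℝ} (hx : 0 < x) :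
    2 * x ^ 2 * Real.cosh x < Real.cosh x * Real.sinh x ^ 2 + x * Real.sinh x := by
  have hc := Real.cosh_pos x
  have h1 := cubic_lt_sinh hx
  have h2 := (lt_div_iff₀ hc).1 (cubic_lt_tanh hx)
  have h3 : x ^ 2 + x ^ 4 / 3 < Real.sinh x ^ 2 := by
    have h0 : 0 < x + x ^ 3 / 6 := by positivity
    have : 0 ≤ x ^ 6 := by positivity
    nlinarith
  have h4 := mul_lt_mul_of_pos_left h3 hc
  have h5 := mul_lt_mul_of_pos_left h2 hx
  nlinarith

lemma strictAntiOn_slope_aux :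
    StrictAntiOn (fun x => cothR x / x + (1 - cothR x ^ 2)) (Ioi 0) := by
  have hd : ∀ x : ℝ, 0 < x → HasDerivAt (fun x => cothR x / x + (1 - cothR x ^ 2))
      (((1 - cothR x ^ 2) * x - cothR x * 1) / x ^ 2
        + -(2 * cothR x * (1 - cothR x ^ 2))) x := fun x hx => by
    have h := hasDerivAt_cothR hx
    simpa using (h.fun_div (hasDerivAt_id' x) hx.ne').fun_add ((h.fun_pow 2).const_sub 1)
  refine strictAntiOn_of_deriv_neg (convex_Ioi 0)
    (fun x hx => (hd x hx).continuousAt.continuousWithinAt) fun x hx => ?_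
  rw [interior_Ioi] at hx
  have hx : 0 < x := hx
  have hs := Real.sinh_pos_iff.2 hx
  rw [(hd x hx).deriv, ← neg_sub (cothR x ^ 2) 1, cothR_sq_sub_one hx]
  have e : (-(1 / Real.sinh x ^ 2) * x - cothR x * 1) / x ^ 2
      + -(2 * cothR x * -(1 / Real.sinh x ^ 2)) =
      -(Real.cosh x * Real.sinh x ^ 2 + x * Real.sinh x - 2 * x ^ 2 * Real.cosh x) /
        (x ^ 2 * Real.sinh x ^ 3) := by
    unfold cothR
    field_simp
    ring
  rw [e]
  exact div_neg_of_neg_of_pos (by linarith [wilker_sinh hx]) (by positivity)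

lemma hasDerivAt_self_mul_cothR_sub_sq (c : ℝ) {t : ℝ} (ht : 0 < t) :
    HasDerivAt (fun t => t * cothR t - t ^ 2 * (c / 2))
      (t * (cothR t / t + (1 - cothR t ^ 2) - c)) t := by
  refine ((hasDerivAt_self_mul_cothR ht).sub
    (((hasDerivAt_id t).pow 2).mul_const (c / 2))).congr_deriv ?_
  simp
  field_simp

/-- Strict concavity of `x coth x` as a function of `x²`: the chord to the left of `y` is
steeper than the tangent at `y`. -/
lemma tangent_lt_chord {x y : ℝ} (hx : 0 < x) (hxy : x < y) :
    (y ^ 2 - x ^ 2) * ((cothR y / y + (1 - cothR y ^ 2)) / 2) < y * cothR y - x * cothR x := by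
  have h : StrictMonoOn
      (fun t => t * cothR t - t ^ 2 * ((cothR y / y + (1 - cothR y ^ 2)) / 2)) (Icc x y) := by
    refine strictMonoOn_of_deriv_pos (convex_Icc x y) (fun t ht =>
      (hasDerivAt_self_mul_cothR_sub_sq _ (hx.trans_le ht.1)).continuousAt.continuousWithinAt)
      fun t ht => ?_
    rw [interior_Icc] at ht
    have ht0 := hx.trans ht.1
    rw [(hasDerivAt_self_mul_cothR_sub_sq _ ht0).deriv]
    exact mul_pos ht0 (sub_pos.2 (strictAntiOn_slope_aux ht0 (hx.trans hxy) ht.2))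
  have := h (left_mem_Icc.2 hxy.le) (right_mem_Icc.2 hxy.le) hxy
  simp only at this
  linarith

/-- Strict concavity of `x coth x` as a function of `x²`: the chord to the right of `y` is
less steep than the tangent at `y`. -/
lemma chord_lt_tangent {y z : ℝ} (hy : 0 < y) (hyz : y < z) :
    z * cothR z - y * cothR y < (z ^ 2 - y ^ 2) * ((cothR y / y + (1 - cothR y ^ 2)) / 2) := by
  have h : StrictAntiOn
      (fun t => t * cothR t - t ^ 2 * ((cothR y / y + (1 - cothR y ^ 2)) / 2)) (Icc y z) := by
    refine strictAntiOn_of_deriv_neg (convex_Icc y z) (fun t ht =>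
      (hasDerivAt_self_mul_cothR_sub_sq _ (hy.trans_le ht.1)).continuousAt.continuousWithinAt)
      fun t ht => ?_
    rw [interior_Icc] at ht
    have ht0 := hy.trans ht.1
    rw [(hasDerivAt_self_mul_cothR_sub_sq _ ht0).deriv]
    exact mul_neg_of_pos_of_neg ht0 (sub_neg.2 (strictAntiOn_slope_aux hy ht0 ht.1))
  have := h (left_mem_Icc.2 hyz.le) (right_mem_Icc.2 hyz.le) hyz
  simp only at this
  linarith

/-- The quantity `L (R² / λ² - 1) (1 - R²) / sinh² L` with `λ = exp (-L)`. -/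
def pfun (L : ℝ) : ℝ := 2 * cothR L - 1 / L - L * (cothR L ^ 2 - 1)

/-- The quantity `(L / sinh² L) (4 - 2 T + D)` with `λ = exp (-L)`; it has the sign of `μ₁`. -/
def gfun (k L : ℝ) : ℝ := 4 * (cothR L - k * cothR (k * L)) + (k ^ 2 - 1) * pfun L

/-- The derivative of `gfun k`. -/
def gfunDeriv (k L : ℝ) : ℝ :=
  4 * ((1 - cothR L ^ 2) - k ^ 2 * (1 - cothR (k * L) ^ 2)) +
    (k ^ 2 - 1) * (3 * (1 - cothR L ^ 2) + 1 / L ^ 2 - 2 * L * cothR L * (1 - cothR L ^ 2))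

lemma hasDerivAt_gfun {k L : ℝ} (hk : 0 < k) (hL : 0 < L) :
    HasDerivAt (gfun k) (gfunDeriv k L) L := by
  have hC := hasDerivAt_cothR hL
  have hK : HasDerivAt (fun x => cothR (k * x)) ((1 - cothR (k * L) ^ 2) * (k * 1)) L :=
    (hasDerivAt_cothR (mul_pos hk hL)).comp L ((hasDerivAt_id' L).const_mul k)
  have hP : HasDerivAt pfun _ L := ((hC.const_mul 2).fun_sub
    ((hasDerivAt_const L (1 : ℝ)).fun_div (hasDerivAt_id' L) hL.ne')).fun_sub
      ((hasDerivAt_id' L).fun_mul ((hC.fun_pow 2).sub_const 1))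
  have hG : HasDerivAt (gfun k) _ L :=
    ((hC.fun_sub (hK.const_mul k)).const_mul 4).fun_add (hP.const_mul (k ^ 2 - 1))
  refine hG.congr_deriv ?_
  unfold gfunDeriv
  simp
  ring

lemma one_lt_self_mul_cothR {x : ℝ} (hx : 0 < x) : 1 < x * cothR x := by
  unfold cothR
  rw [← mul_div_assoc]
  exact (one_lt_div (Real.sinh_pos_iff.2 hx)).2 (sinh_lt_mul_cosh hx)

lemma sq_mul_cothR_sq_sub_one_lt {x : ℝ} (hx : 0 < x) : x ^ 2 * (cothR x ^ 2 - 1) < 1 := by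
  have h := self_lt_sinh hx
  rw [cothR_sq_sub_one hx, mul_one_div]
  exact (div_lt_one (by positivity)).2 (by gcongr)

lemma pfun_pos {L : ℝ} (hL : 0 < L) : 0 < pfun L := by
  have hs := Real.sinh_pos_iff.2 hL
  have h1 : 0 < Real.exp (2 * L) - 1 - 2 * L := by
    linarith [Real.add_one_lt_exp (x := 2 * L) (by positivity)]
  have h2 : 0 < Real.exp (-(2 * L)) - 1 + 2 * L := by
    linarith [Real.add_one_lt_exp (x := -(2 * L)) (by simpa using hL.ne')]
  have e : pfun L = (Real.exp (2 * L) - 1 - 2 * L) * (Real.exp (-(2 * L)) - 1 + 2 * L) /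
      (4 * L * Real.sinh L ^ 2) := by
    have e1 : Real.exp (2 * L) = (Real.cosh L + Real.sinh L) ^ 2 := by
      rw [Real.cosh_add_sinh, ← Real.exp_nat_mul]; norm_num
    have e2 : Real.exp (-(2 * L)) = (Real.cosh L - Real.sinh L) ^ 2 := by
      rw [Real.cosh_sub_sinh, ← Real.exp_nat_mul]; norm_num
    have hc := Real.cosh_sq L
    have f1 : (Real.cosh L + Real.sinh L) ^ 2 - 1 - 2 * L =
        2 * (Real.sinh L ^ 2 + (Real.cosh L * Real.sinh L - L)) := by linear_combination hc
    have f2 : (Real.cosh L - Real.sinh L) ^ 2 - 1 + 2 * L =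
        2 * (Real.sinh L ^ 2 - (Real.cosh L * Real.sinh L - L)) := by linear_combination hc
    unfold pfun
    rw [e1, e2, f1, f2, cothR_sq_sub_one hL]
    unfold cothR
    field_simp
    linear_combination 4 * Real.sinh L ^ 2 * hc
  rw [e]
  positivity

lemma one_lt_of_quadratics {F a s w : ℝ} (hs : s = (F - 1) ^ 2 + a) (ha : 0 < a)
    (hF : 2 * (F - 1) < a) (hF1 : 1 < F) (hw : 0 < w)
    (h1 : 0 < a * (F + w) ^ 2 - s * (a + 4 * w))
    (h2 : 0 < a * (a + 4 * w) - 2 * a * (F + w) - 2 * s * (a + 4 * w) + 2 * a * (F + w) ^ 2) :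
    1 < w := by
  by_contra! hw1
  have q0 : a - 2 * F - 2 * s + 2 * F ^ 2 < 0 := by rw [hs]; linarith
  have hsq : 0 < (a - 2 * (F - 1)) ^ 2 := by have := sub_pos.2 hF; positivity
  have hc : 2 * s - a * F < a * w := by
    by_contra! hc
    have haw : 0 < a * w := by positivity
    have hs2 : a < 2 * s := by nlinarith
    have t1 : 0 ≤ (2 * s - a * F - a * w) * (a ^ 2 * -(a - 2 * F - 2 * s + 2 * F ^ 2)) :=
      mul_nonneg (by linarith) (mul_nonneg (by positivity) (by linarith))
    have t2 : 0 < a * w * ((a - 2 * (F - 1)) ^ 2 * (2 * s - a)) :=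
      mul_pos haw (mul_pos hsq (by linarith))
    have t3 : 0 ≤ 2 * (2 * s - a * F) * (a * w) * (2 * s - a * F - a * w) :=
      mul_nonneg (mul_nonneg (by linarith) haw.le) (by linarith)
    have t4 := mul_pos (haw.trans_le hc) (mul_pos ha h2)
    have hn : (a - 2 * (F - 1)) ^ 2 = a ^ 2 - 4 * a * F + 4 * s := by rw [hs]; ring
    rw [hn] at t2
    linarith
  have h3 : 0 ≤ (1 - w) * (a * (1 + w) + 2 * a * F - 4 * s) :=
    mul_nonneg (by linarith) (by nlinarith)
  have h4 : a * (F + 1) ^ 2 - s * (a + 4) = -(a - 2 * (F - 1)) ^ 2 := by rw [hs]; ring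
  linarith

lemma gfunDeriv_pos {k L : ℝ} (hk : 1 < k) (hL : 0 < L) (h0 : gfun k L = 0) :
    0 < gfunDeriv k L := by
  have hkL : L < k * L := by nlinarith
  have hkL0 : 0 < k * L := hL.trans hkL
  have hP := pfun_pos hL
  have hV := sq_mul_cothR_sq_sub_one_lt hL
  have hF1 := one_lt_self_mul_cothR hL
  have hmono := strictMonoOn_self_mul_cothR hL hkL0 hkL
  have hy := one_lt_cothR hkL0
  have htan := tangent_lt_chord hL hkL
  have hpfun : L * pfun L = 2 * (L * cothR L) - 1 - L ^ 2 * (cothR L ^ 2 - 1) := by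
    unfold pfun; field_simp
  unfold gfun at h0
  unfold gfunDeriv
  simp only at hmono
  generalize cothR L = C at *
  generalize cothR (k * L) = K at *
  generalize pfun L = P at *
  set w := k * L * K - L * C with hw
  have hw0 : 0 < w := by linarith
  have hzero : 4 * w = (k ^ 2 - 1) * (L * P) := by rw [hw]; linear_combination -L * h0
  have hlt : 1 < w := by
    have ha : 0 < L * P := by positivity
    refine one_lt_of_quadratics (F := L * C) (a := L * P) (s := L ^ 2) ?_ ha ?_ hF1 hw0 ?_ ?_
    · rw [hpfun]; ring
    · linarith
    · have : L * P * (L * C + w) ^ 2 - L ^ 2 * (L * P + 4 * w) =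
          L * P * (k * L) ^ 2 * (K ^ 2 - 1) := by
        rw [hzero, hw]; ring
      rw [this]
      have : 0 < K ^ 2 - 1 := by nlinarith
      positivity
    · have hm : (k * L) * K + (k * L) ^ 2 - ((k * L) * K) ^ 2 < k ^ 2 * (L * P) / 2 := by
        have hd : 0 < (k ^ 2 - 1) / (2 * k ^ 2) := by
          have : 0 < k ^ 2 - 1 := by nlinarith
          positivity
        refine lt_of_mul_lt_mul_left ?_ hd.le
        have hw' : w = (k ^ 2 - 1) * (L * P) / 4 := by linarith
        rw [hw'] at htan
        have hk0 : k ≠ 0 := by positivity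
        calc _ = ((k * L) ^ 2 - L ^ 2) * ((K / (k * L) + (1 - K ^ 2)) / 2) := by
              field_simp; ring
          _ < _ := htan
          _ = _ := by field_simp; ring
      have hz : L * P + 4 * w = k ^ 2 * (L * P) := by linarith
      have hf : L * C + w = k * L * K := by rw [hw]; ring
      rw [hz, hf]
      have := mul_pos ha (sub_pos.2 hm)
      linarith
  have e : 4 * ((1 - C ^ 2) - k ^ 2 * (1 - K ^ 2)) +
      (k ^ 2 - 1) * (3 * (1 - C ^ 2) + 1 / L ^ 2 - 2 * L * C * (1 - C ^ 2)) =
      4 * w * (w - 1) / L ^ 2 := by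
    have hq : 3 * (1 - C ^ 2) + 1 / L ^ 2 - 2 * L * C * (1 - C ^ 2) =
        (4 * L ^ 2 - L * P - 2 * (L * P) * (L * C)) / L ^ 2 := by
      rw [hpfun]; field_simp; ring
    rw [hq]
    field_simp
    rw [hw] at hzero ⊢
    linear_combination (1 + 2 * L * C) * hzero
  rw [e]
  have := sub_pos.2 hlt
  positivity

lemma gfun_pos_of_lt {k k' L : ℝ} (hk : 1 < k) (hkk : k < k') (hL : 0 < L)
    (h0 : gfun k L = 0) : 0 < gfun k' L := by
  have hkL : L < k * L := by nlinarith
  have hkL' : k * L < k' * L := by nlinarith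
  have h1 := tangent_lt_chord hL hkL
  have h2 := chord_lt_tangent (hL.trans hkL) hkL'
  unfold gfun at *
  generalize cothR L = C at *
  generalize (cothR (k * L) / (k * L) + (1 - cothR (k * L) ^ 2)) / 2 = m at *
  generalize cothR (k * L) = K at *
  generalize cothR (k' * L) = K' at *
  generalize pfun L = P at *
  have hz : 4 * (k * L * K - L * C) = (k ^ 2 - 1) * (L * P) := by linear_combination -L * h0
  have hd : 0 < k ^ 2 - 1 := by nlinarith
  have hd' : 0 < k' ^ 2 - k ^ 2 := by nlinarith
  have hm : 4 * (L ^ 2 * m) < L * P := by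
    refine lt_of_mul_lt_mul_left ?_ hd.le
    linarith
  have := mul_lt_mul_of_pos_left hm hd'
  refine pos_of_mul_pos_right (a := L) ?_ hL.le
  nlinarith

lemma neg_log_pos {l : ℝ} (hl : l ∈ Ioo (0 : ℝ) 1) : 0 < -Real.log l :=
  neg_pos.2 (Real.log_neg hl.1 hl.2)

lemma self_eq_cosh_sub_sinh {l : ℝ} (hl : l ∈ Ioo (0 : ℝ) 1) :
    l = Real.cosh (-Real.log l) - Real.sinh (-Real.log l) := by
  rw [Real.cosh_sub_sinh, neg_neg, Real.exp_log hl.1]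

lemma inv_self_eq_cosh_add_sinh {l : ℝ} (hl : l ∈ Ioo (0 : ℝ) 1) :
    l⁻¹ = Real.cosh (-Real.log l) + Real.sinh (-Real.log l) := by
  rw [Real.cosh_add_sinh, Real.exp_neg, Real.exp_log hl.1]

lemma Rsq_eq {l : ℝ} (hl : l ∈ Ioo (0 : ℝ) 1) :
    Rsq l = Real.sinh (-Real.log l) *
      (Real.cosh (-Real.log l) - Real.sinh (-Real.log l)) / (-Real.log l) := by
  have hL := neg_log_pos hl
  have h : 1 - l ^ 2 = 2 * (Real.sinh (-Real.log l) *
      (Real.cosh (-Real.log l) - Real.sinh (-Real.log l))) := by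
    conv_lhs => rw [self_eq_cosh_sub_sinh hl]
    linear_combination Real.cosh_sq (-Real.log l) * (-1)
  have e : -2 * Real.log l = 2 * (-Real.log l) := by ring
  rw [Rsq, h, e, mul_div_mul_left _ _ two_ne_zero]

lemma Rsq_div_sq_eq {l : ℝ} (hl : l ∈ Ioo (0 : ℝ) 1) :
    Rsq l / l ^ 2 = Real.sinh (-Real.log l) *
      (Real.cosh (-Real.log l) + Real.sinh (-Real.log l)) / (-Real.log l) := by
  have h : (Real.cosh (-Real.log l) - Real.sinh (-Real.log l)) * (l⁻¹) ^ 2 = l⁻¹ := by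
    rw [← self_eq_cosh_sub_sinh hl, sq, mul_inv_cancel_left₀ hl.1.ne']
  rw [← inv_self_eq_cosh_add_sinh hl, div_eq_mul_inv, ← inv_pow, Rsq_eq hl]
  linear_combination Real.sinh (-Real.log l) / (-Real.log l) * h

lemma Rsq_lt_one {l : ℝ} (hl : l ∈ Ioo (0 : ℝ) 1) : Rsq l < 1 := by
  have hL := neg_log_pos hl
  have h := Real.add_one_lt_exp (x := 2 * Real.log l) (by linarith)
  have e : Real.exp (2 * Real.log l) = l ^ 2 := by
    rw [two_mul, Real.exp_add, Real.exp_log hl.1, sq]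
  rw [Rsq, div_lt_one (by linarith)]
  linarith

lemma sq_lt_Rsq {l : ℝ} (hl : l ∈ Ioo (0 : ℝ) 1) : l ^ 2 < Rsq l := by
  have hL := neg_log_pos hl
  have h := Real.add_one_lt_exp (x := 2 * -Real.log l) (by linarith)
  have e : Real.exp (2 * -Real.log l) = (l ^ 2)⁻¹ := by
    rw [two_mul, Real.exp_add, Real.exp_neg, Real.exp_log hl.1, sq, mul_inv]
  rw [e, lt_inv_comm₀ (by linarith) (by have := hl.1; positivity),
    ← one_div, lt_div_iff₀ (by linarith)] at h
  rw [Rsq, lt_div_iff₀ (by linarith)]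
  linarith

lemma Rsq_pos {l : ℝ} (hl : l ∈ Ioo (0 : ℝ) 1) : 0 < Rsq l :=
  (sq_nonneg l).trans_lt (sq_lt_Rsq hl)

lemma one_lt_Rsq_div_sq {l : ℝ} (hl : l ∈ Ioo (0 : ℝ) 1) : 1 < Rsq l / l ^ 2 :=
  (one_lt_div (by have := hl.1; positivity)).2 (sq_lt_Rsq hl)

lemma om_eq (l k : ℝ) : om l k = k * -Real.log l := by
  unfold om; ring

lemma Tfun_eq {l : ℝ} (hl : l ∈ Ioo (0 : ℝ) 1) (k : ℝ) :
    Tfun l k = 2 * Real.sinh (-Real.log l) ^ 2 / (-Real.log l) *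
      (k * cothR (k * -Real.log l) - cothR (-Real.log l)) + 2 := by
  have hL := neg_log_pos hl
  have hs := (Real.sinh_pos_iff.2 hL).ne'
  have h : Tfun l k = (Rsq l / l ^ 2 - Rsq l) * (k * cothR (k * -Real.log l))
      + 2 - Rsq l - Rsq l / l ^ 2 := by
    rw [Tfun, om_eq]; ring
  rw [h, Rsq_div_sq_eq hl, Rsq_eq hl]
  generalize k * cothR (k * -Real.log l) = K
  generalize -Real.log l = L at *
  unfold cothR
  field_simp
  ring

lemma Dfun_eq {l : ℝ} (hl : l ∈ Ioo (0 : ℝ) 1) (k : ℝ) :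
    Dfun l k = Real.sinh (-Real.log l) ^ 2 / (-Real.log l) *
      ((k ^ 2 - 1) * pfun (-Real.log l)) := by
  have hL := neg_log_pos hl
  have hs := (Real.sinh_pos_iff.2 hL).ne'
  rw [Dfun, Rsq_div_sq_eq hl, Rsq_eq hl]
  generalize -Real.log l = L at *
  rw [pfun, cothR_sq_sub_one hL]
  unfold cothR
  field_simp
  linear_combination (1 - k ^ 2) * Real.sinh L ^ 2 * Real.cosh_sq L

lemma charpoly_two_eq {l : ℝ} (hl : l ∈ Ioo (0 : ℝ) 1) (k : ℝ) :
    4 - 2 * Tfun l k + Dfun l k =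
      Real.sinh (-Real.log l) ^ 2 / (-Real.log l) * gfun k (-Real.log l) := by
  rw [Tfun_eq hl, Dfun_eq hl, gfun]
  ring

lemma Tfun_eq_add (l k : ℝ) :
    Tfun l k = (Rsq l / l ^ 2 - 1) * (k * cothR (k * -Real.log l) - 1) +
      (1 - Rsq l) * (k * cothR (k * -Real.log l) + 1) := by
  rw [Tfun, om_eq]; ring

lemma discrim_pos {l k : ℝ} (hl : l ∈ Ioo (0 : ℝ) 1) (hk : 0 < k) :
    0 < Tfun l k ^ 2 - 4 * Dfun l k := by
  have hL := neg_log_pos hl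
  have hA := sub_pos.2 (one_lt_Rsq_div_sq hl)
  have hB := sub_pos.2 (Rsq_lt_one hl)
  have hc := one_lt_cothR (mul_pos hk hL)
  rw [Tfun_eq_add, Dfun]
  generalize cothR (k * -Real.log l) = c at *
  generalize Rsq l / l ^ 2 - 1 = A at *
  generalize 1 - Rsq l = B at *
  have h : 0 < 4 * (A * B) * (k ^ 2 * (c ^ 2 - 1)) := by
    have : 0 < c ^ 2 - 1 := by nlinarith
    positivity
  nlinarith [sq_nonneg ((A - B) * (k * c) - (A + B))]

lemma mu1_mul_mu2 {l k : ℝ} (hl : l ∈ Ioo (0 : ℝ) 1) (hk : 0 < k) :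
    mu1 l k * mu2 l k =
      Real.sinh (-Real.log l) ^ 2 / (-Real.log l) * gfun k (-Real.log l) := by
  rw [← charpoly_two_eq hl, mu1, mu2]
  linear_combination (-1 / 4) * Real.sq_sqrt (discrim_pos hl hk).le

lemma strictMonoOn_mul_cothR_add_inv_sinh {L : ℝ} (hL : 0 < L) :
    StrictMonoOn (fun k => k * cothR (k * L) + k / Real.sinh (k * L)) (Ioi 0) := by
  have e : ∀ k : ℝ, 0 < k → k * cothR (k * L) + k / Real.sinh (k * L) =
      2 / L * ((k * L / 2) * cothR (k * L / 2)) := fun k hk => by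
    have hs : Real.sinh (k * L / 2) ≠ 0 := (Real.sinh_pos_iff.2 (by positivity)).ne'
    have hc := (Real.cosh_pos (k * L / 2)).ne'
    have h2 : k * L = 2 * (k * L / 2) := by ring
    unfold cothR
    rw [← mul_div_assoc, ← add_div, h2, Real.sinh_two_mul, Real.cosh_two_mul, ← h2]
    field_simp
    linear_combination Real.cosh_sq (k * L / 2) * (-1)
  intro a ha b hb hab
  have ha : 0 < a := ha
  have hb : 0 < b := hb
  simp only [e a ha, e b hb]
  refine mul_lt_mul_of_pos_left (strictMonoOn_self_mul_cothR ?_ ?_ ?_) (by positivity)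
  · exact div_pos (mul_pos ha hL) two_pos
  · exact div_pos (mul_pos hb hL) two_pos
  · gcongr

/-- A symmetric `2 × 2` matrix with trace at most `4` and with `det (M - 2) ≥ 0` cannot strictly
dominate one having the eigenvalue `2`. -/
lemma charpoly_two_neg {A B S C p q k : ℝ} (hA : 0 < A) (hB : 0 < B) (hC : 1 < C) (hSC : C < S)
    (hp : 0 < p) (hq : 0 < q) (hCp : C ^ 2 - 1 = p ^ 2) (hSq : S ^ 2 - k ^ 2 = q ^ 2)
    (h1 : A * (C - 1) + B * (C + 1) = 2) (hpq : C + p < S + q)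
    (hT : A * (S - 1) + B * (S + 1) ≤ 4) :
    4 - 2 * (A * (S - 1) + B * (S + 1)) + A * B * (k ^ 2 - 1) < 0 := by
  by_contra! h
  set d := S - C with hd
  have hS : S = C + d := by rw [hd]; ring
  have hd0 : 0 < d := sub_pos.2 hSC
  have hAB := mul_pos hA hB
  have hu : B * (C + 1) - A * d = 2 - A * (S - 1) := by rw [hS]; linear_combination h1
  have hv : A * (C - 1) - B * d = 2 - B * (S + 1) := by rw [hS]; linear_combination h1
  have huv : (B * (C + 1) - A * d) * (A * (C - 1) - B * d) =
      4 - 2 * (A * (S - 1) + B * (S + 1)) + A * B * (k ^ 2 - 1) + A * B * q ^ 2 := by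
    rw [hu, hv, ← hSq]; ring
  have huv0 : A * B * q ^ 2 ≤ (B * (C + 1) - A * d) * (A * (C - 1) - B * d) := by linarith
  have hpos : 0 < (B * (C + 1) - A * d) * (A * (C - 1) - B * d) :=
    lt_of_lt_of_le (by positivity) huv0
  have hu0 : 0 < B * (C + 1) - A * d := by
    by_contra! hneg
    nlinarith
  have hv0 := pos_of_mul_pos_right hpos hu0.le
  have hdp : d < p := by
    refine lt_of_pow_lt_pow_left₀ 2 hp.le (lt_of_mul_lt_mul_left ?_ hAB.le)
    calc A * B * d ^ 2 = (A * d) * (B * d) := by ring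
      _ < (B * (C + 1)) * (A * (C - 1)) :=
        mul_lt_mul'' (by linarith) (by linarith) (by positivity) (by positivity)
      _ = A * B * p ^ 2 := by rw [← hCp]; ring
  have hamgm : 2 * (A * B * p) ≤ A ^ 2 * (C - 1) + B ^ 2 * (C + 1) := by
    have hC1 := sub_pos.2 hC
    refine le_of_sq_le_sq ?_ (by positivity)
    have : (2 * (A * B * p)) ^ 2 = 4 * ((A ^ 2 * (C - 1)) * (B ^ 2 * (C + 1))) := by
      linear_combination -4 * (A * B) ^ 2 * hCp
    nlinarith [sq_nonneg (A ^ 2 * (C - 1) - B ^ 2 * (C + 1))]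
  have hle : A * B * q ^ 2 ≤ A * B * (p - d) ^ 2 := by
    have e : (B * (C + 1) - A * d) * (A * (C - 1) - B * d) =
        A * B * (p ^ 2 + d ^ 2) - d * (A ^ 2 * (C - 1) + B ^ 2 * (C + 1)) := by
      rw [← hCp]; ring
    have := mul_le_mul_of_nonneg_left hamgm hd0.le
    linarith
  have := le_of_mul_le_mul_left hle hAB
  have := pow_lt_pow_left₀ (show p - d < q by linarith) (by linarith) two_ne_zero
  linarith

lemma mu2_pos {l k : ℝ} (hl : l ∈ Ioo (0 : ℝ) 1) (hk : 1 < k) : 0 < mu2 l k := by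
  have hL := neg_log_pos hl
  have hk0 : 0 < k := by linarith
  have hkL := mul_pos hk0 hL
  have h : 4 - Tfun l k < Real.sqrt (Tfun l k ^ 2 - 4 * Dfun l k) := by
    rcases lt_or_ge 4 (Tfun l k) with hT | hT
    · exact (sub_neg.2 hT).trans_le (Real.sqrt_nonneg _)
    refine Real.lt_sqrt_of_sq_lt ?_
    have h1 := Tfun_eq_add l 1
    rw [Tfun_eq hl 1] at h1
    simp only [one_mul, sub_self, mul_zero, zero_add] at h1
    have hmono := strictMonoOn_self_mul_cothR hL hkL (by nlinarith)
    have hpq := strictMonoOn_mul_cothR_add_inv_sinh hL (mem_Ioi.2 one_pos) hk0 hk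
    simp only [one_mul] at hmono hpq
    have := charpoly_two_neg (A := Rsq l / l ^ 2 - 1) (B := 1 - Rsq l)
      (S := k * cothR (k * -Real.log l)) (C := cothR (-Real.log l))
      (p := 1 / Real.sinh (-Real.log l)) (q := k / Real.sinh (k * -Real.log l)) (k := k)
      (sub_pos.2 (one_lt_Rsq_div_sq hl)) (sub_pos.2 (Rsq_lt_one hl)) (one_lt_cothR hL)
      (by nlinarith)
      (one_div_pos.2 (Real.sinh_pos_iff.2 hL)) (div_pos hk0 (Real.sinh_pos_iff.2 hkL))
      (by rw [cothR_sq_sub_one hL, one_div_pow])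
      (by rw [div_pow, ← mul_one_div, ← cothR_sq_sub_one hkL]; ring)
      h1.symm hpq (by rwa [← Tfun_eq_add])
    rw [← Tfun_eq_add, ← Dfun] at this
    linarith
  unfold mu2
  linarith

lemma mu1_pos_iff {l k : ℝ} (hl : l ∈ Ioo (0 : ℝ) 1) (hk : 1 < k) :
    0 < mu1 l k ↔ 0 < gfun k (-Real.log l) := by
  have hL := neg_log_pos hl
  have hs := Real.sinh_pos_iff.2 hL
  rw [← mul_pos_iff_of_pos_right (mu2_pos hl hk), mu1_mul_mu2 hl (by linarith),
    mul_pos_iff_of_pos_left (by positivity)]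

lemma mu1_eq_zero_iff {l k : ℝ} (hl : l ∈ Ioo (0 : ℝ) 1) (hk : 1 < k) :
    mu1 l k = 0 ↔ gfun k (-Real.log l) = 0 := by
  have hL := neg_log_pos hl
  have hs := Real.sinh_pos_iff.2 hL
  have hc : Real.sinh (-Real.log l) ^ 2 / (-Real.log l) ≠ 0 := by positivity
  rw [← mul_eq_zero_iff_right (mu2_pos hl hk).ne', mu1_mul_mu2 hl (by linarith),
    mul_eq_zero_iff_left hc]

lemma differentiableAt_Tfun {l k : ℝ} (hl : l ∈ Ioo (0 : ℝ) 1) (hk : 0 < k) :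
    DifferentiableAt ℝ (fun l => Tfun l k) l := by
  have hl0 : l ≠ 0 := hl.1.ne'
  have hlog : -2 * Real.log l ≠ 0 := by linarith [neg_log_pos hl]
  have hR : DifferentiableAt ℝ Rsq l := by unfold Rsq; fun_prop (disch := assumption)
  have ho : DifferentiableAt ℝ (fun l => om l k) l := by unfold om; fun_prop (disch := assumption)
  have hc : DifferentiableAt ℝ (fun l => cothR (om l k)) l :=
    DifferentiableAt.comp (g := cothR) l (hasDerivAt_cothR (by
      rw [om_eq]; exact mul_pos hk (neg_log_pos hl))).differentiableAt ho
  have hl2 : l ^ 2 ≠ 0 := pow_ne_zero 2 hl0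
  unfold Tfun
  fun_prop (disch := assumption)

lemma differentiableAt_sqrt_discrim {l k : ℝ} (hl : l ∈ Ioo (0 : ℝ) 1) (hk : 0 < k) :
    DifferentiableAt ℝ (fun l => Real.sqrt (Tfun l k ^ 2 - 4 * Dfun l k)) l := by
  have hl0 : l ≠ 0 := hl.1.ne'
  have hlog : -2 * Real.log l ≠ 0 := by linarith [neg_log_pos hl]
  have hR : DifferentiableAt ℝ Rsq l := by unfold Rsq; fun_prop (disch := assumption)
  have hT := differentiableAt_Tfun hl hk
  have hl2 : l ^ 2 ≠ 0 := pow_ne_zero 2 hl0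
  have hD : DifferentiableAt ℝ (fun l => Dfun l k) l := by
    unfold Dfun; fun_prop (disch := assumption)
  exact ((hT.pow 2).sub (hD.const_mul 4)).sqrt (discrim_pos hl hk).ne'

lemma differentiableAt_mu1 {l k : ℝ} (hl : l ∈ Ioo (0 : ℝ) 1) (hk : 0 < k) :
    DifferentiableAt ℝ (fun l => mu1 l k) l :=
  (((differentiableAt_Tfun hl hk).sub (differentiableAt_sqrt_discrim hl hk)).div_const 2).sub_const
    2

lemma differentiableAt_mu2 {l k : ℝ} (hl : l ∈ Ioo (0 : ℝ) 1) (hk : 0 < k) :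
    DifferentiableAt ℝ (fun l => mu2 l k) l :=
  (((differentiableAt_Tfun hl hk).add (differentiableAt_sqrt_discrim hl hk)).div_const 2).sub_const
    2

lemma deriv_mu1_neg {l k : ℝ} (hl : l ∈ Ioo (0 : ℝ) 1) (hk : 1 < k) (h0 : mu1 l k = 0) :
    deriv (fun l => mu1 l k) l < 0 := by
  have hk0 : 0 < k := by linarith
  have hL := neg_log_pos hl
  have hs := Real.sinh_pos_iff.2 hL
  have hg := (mu1_eq_zero_iff hl hk).1 h0
  have hlog : HasDerivAt (fun l => -Real.log l) (-l⁻¹) l := (Real.hasDerivAt_log hl.1.ne').neg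
  have hG : HasDerivAt (fun l => gfun k (-Real.log l)) (gfunDeriv k (-Real.log l) * -l⁻¹) l :=
    HasDerivAt.comp (h₂ := gfun k) l (hasDerivAt_gfun hk0 hL) hlog
  have hc : HasDerivAt (fun l => Real.sinh (-Real.log l) ^ 2 / (-Real.log l)) _ l :=
    ((hlog.sinh.fun_pow 2).fun_div hlog hL.ne')
  have h1 := ((differentiableAt_mu1 hl hk0).hasDerivAt.fun_mul
    (differentiableAt_mu2 hl hk0).hasDerivAt)
  have h2 := (hc.fun_mul hG).congr_of_eventuallyEq (f₁ := fun l => mu1 l k * mu2 l k)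
    (by filter_upwards [isOpen_Ioo.mem_nhds hl] with x hx using mu1_mul_mu2 hx hk0)
  have h := h1.unique h2
  rw [h0, hg, zero_mul, add_zero, mul_zero, zero_add] at h
  have hneg : deriv (fun l => mu1 l k) l * mu2 l k < 0 := by
    rw [h]
    have := gfunDeriv_pos hk hL hg
    have hl0 := hl.1
    have : 0 < Real.sinh (-Real.log l) ^ 2 / (-Real.log l) *
      (gfunDeriv k (-Real.log l) * l⁻¹) := by positivity
    linarith
  exact neg_of_mul_neg_left hneg (mu2_pos hl hk).le

/-- A function crossing zero only downwards stays negative once it is nonpositive. -/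
lemma neg_of_deriv_neg_at_zeros {f : ℝ → ℝ} {a b : ℝ} (hab : a < b)
    (hd : ∀ x ∈ Icc a b, DifferentiableAt ℝ f x) (hneg : ∀ x ∈ Icc a b, f x = 0 → deriv f x < 0)
    (ha : f a ≤ 0) : f b < 0 := by
  have hle : ∀ ⦃x⦄, x ∈ Icc a b → f x ≤ 0 :=
    image_le_of_deriv_right_lt_deriv_boundary (B := fun _ => 0) (B' := fun _ => 0) (f' := deriv f)
      (fun x hx => (hd x hx).continuousAt.continuousWithinAt)
      (fun x hx => (hd x (Ico_subset_Icc_self hx)).hasDerivAt.hasDerivWithinAt) ha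
      (fun x => hasDerivAt_const x 0) (fun x hx => hneg x (Ico_subset_Icc_self hx))
  have hb : b ∈ Icc a b := right_mem_Icc.2 hab.le
  refine lt_of_le_of_ne (hle hb) fun h0 => ?_
  have hslope := (hd b hb).hasDerivAt.tendsto_slope.mono_left (nhdsLT_le_nhdsNE b)
  have hev := hslope.eventually (gt_mem_nhds (hneg b hb h0))
  obtain ⟨x, hx, hxa, hxb⟩ := (hev.and (Ioo_mem_nhdsLT hab)).exists
  rw [slope_def_field, h0, sub_zero] at hx
  exact absurd (div_nonneg_of_nonpos (hle ⟨hxa.le, hxb.le⟩) (sub_neg.2 hxb).le) (not_le.2 hx)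

lemma two_lt_Tfun {l k : ℝ} (hl : l ∈ Ioo (0 : ℝ) 1) (hk : 1 < k) : 2 < Tfun l k := by
  have hL := neg_log_pos hl
  have hs := Real.sinh_pos_iff.2 hL
  have hkL : -Real.log l < k * -Real.log l := by nlinarith
  have hmono := strictMonoOn_self_mul_cothR hL (hL.trans hkL) hkL
  simp only at hmono
  have h : 0 < k * cothR (k * -Real.log l) - cothR (-Real.log l) := by
    refine pos_of_mul_pos_right (a := -Real.log l) ?_ hL.le
    linarith
  rw [Tfun_eq hl]
  have : 0 < 2 * Real.sinh (-Real.log l) ^ 2 / (-Real.log l) *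
      (k * cothR (k * -Real.log l) - cothR (-Real.log l)) := by positivity
  linarith

lemma tendsto_neg_log_atTop :
    Tendsto (fun l : ℝ => -Real.log l) (𝓝[Ioo 0 1] 0) atTop :=
  tendsto_neg_atBot_atTop.comp
    (Real.tendsto_log_nhdsGT_zero.mono_left (nhdsWithin_mono _ Ioo_subset_Ioi_self))

lemma tendsto_Rsq_zero : Tendsto Rsq (𝓝[Ioo 0 1] 0) (𝓝 0) := by
  have h1 : Tendsto (fun l : ℝ => 1 - l ^ 2) (𝓝[Ioo 0 1] 0) (𝓝 (1 - 0 ^ 2)) :=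
    ((by fun_prop : Continuous fun l : ℝ => 1 - l ^ 2).tendsto 0).mono_left nhdsWithin_le_nhds
  have h2 := tendsto_neg_log_atTop.const_mul_atTop (two_pos (α := ℝ))
  refine (h1.div_atTop h2).congr fun l => ?_
  rw [Rsq]
  ring

lemma tendsto_sq_div_Rsq_zero : Tendsto (fun l => l ^ 2 / Rsq l) (𝓝[Ioo 0 1] 0) (𝓝 0) := by
  have h1 : Tendsto (fun l : ℝ => -2 * l / (1 - l ^ 2)) (𝓝[Ioo 0 1] 0) (𝓝 0) := by
    have : ContinuousAt (fun l : ℝ => -2 * l / (1 - l ^ 2)) 0 := by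
      fun_prop (disch := norm_num)
    simpa using this.tendsto.mono_left nhdsWithin_le_nhds
  have h2 : Tendsto (fun l : ℝ => Real.log l * l) (𝓝[Ioo 0 1] 0) (𝓝 0) :=
    (by simpa using tendsto_log_mul_rpow_nhdsGT_zero one_pos :
      Tendsto (fun l : ℝ => Real.log l * l) (𝓝[>] 0) (𝓝 0)).mono_left
        (nhdsWithin_mono _ Ioo_subset_Ioi_self)
  refine (by simpa using h1.mul h2 : Tendsto (fun l : ℝ => -2 * l / (1 - l ^ 2) * (Real.log l * l))
    (𝓝[Ioo 0 1] 0) (𝓝 0)).congr fun l => ?_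
  rw [Rsq, div_div_eq_mul_div]
  ring

lemma tendsto_mu1_zero {k : ℝ} (hk : 1 < k) :
    Tendsto (fun l => mu1 l k) (𝓝[Ioo 0 1] 0) (𝓝 (k - 1)) := by
  have hk0 : 0 < k := by linarith
  have hc := tendsto_sq_div_Rsq_zero
  have hR := tendsto_Rsq_zero
  have hl : Tendsto (fun l : ℝ => l ^ 2) (𝓝[Ioo 0 1] 0) (𝓝 0) := by
    simpa using ((continuous_pow 2).tendsto (0 : ℝ)).mono_left nhdsWithin_le_nhds
  have hcoth : Tendsto (fun l => cothR (om l k)) (𝓝[Ioo 0 1] 0) (𝓝 1) := by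
    refine tendsto_cothR_atTop.comp ((tendsto_neg_log_atTop.const_mul_atTop hk0).congr fun l => ?_)
    rw [om_eq]
  have hT : Tendsto (fun l => l ^ 2 / Rsq l * Tfun l k) (𝓝[Ioo 0 1] 0) (𝓝 (k - 1)) := by
    have h := ((((hl.const_sub 1).mul_const k).mul hcoth).add (hc.const_mul 2)).sub (hl.add_const 1)
    simp only [sub_zero, one_mul, mul_one, mul_zero, add_zero, zero_add] at h
    refine h.congr' ?_
    filter_upwards [self_mem_nhdsWithin] with l hl
    have := (Rsq_pos hl).ne'
    have := hl.1.ne'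
    unfold Tfun
    field_simp
    ring
  have hD : Tendsto (fun l => l ^ 2 / Rsq l * Dfun l k) (𝓝[Ioo 0 1] 0) (𝓝 (k ^ 2 - 1)) := by
    have h := ((hc.const_sub 1).mul (hR.const_sub 1)).mul_const (k ^ 2 - 1)
    simp only [sub_zero, one_mul] at h
    refine h.congr' ?_
    filter_upwards [self_mem_nhdsWithin] with l hl
    have := (Rsq_pos hl).ne'
    have := hl.1.ne'
    unfold Dfun
    field_simp
  have hden := hT.add (((hT.pow 2).sub ((hc.const_mul 4).mul hD)).sqrt)
  have hlim := ((hD.const_mul 2).div hden ?_).sub_const 2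
  · have e : Real.sqrt ((k - 1) ^ 2 - 4 * 0 * (k ^ 2 - 1)) = k - 1 := by
      rw [mul_zero, zero_mul, sub_zero, Real.sqrt_sq (by linarith)]
    have e2 : 2 * (k ^ 2 - 1) / (k - 1 + (k - 1)) - 2 = k - 1 := by
      have : k - 1 ≠ 0 := by linarith
      have : k - 1 + (k - 1) ≠ 0 := by linarith
      field_simp
      ring
    rw [e, e2] at hlim
    refine hlim.congr' ?_
    filter_upwards [self_mem_nhdsWithin] with l hl
    have hl0 := hl.1
    have hRp := Rsq_pos hl
    have hcp : 0 < l ^ 2 / Rsq l := by positivity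
    have hdisc := discrim_pos hl hk0
    have hTp := two_lt_Tfun hl hk
    simp only [Pi.div_apply]
    generalize l ^ 2 / Rsq l = c at *
    have e3 : Real.sqrt ((c * Tfun l k) ^ 2 - 4 * c * (c * Dfun l k)) =
        c * Real.sqrt (Tfun l k ^ 2 - 4 * Dfun l k) := by
      rw [show (c * Tfun l k) ^ 2 - 4 * c * (c * Dfun l k) =
        c ^ 2 * (Tfun l k ^ 2 - 4 * Dfun l k) by ring, Real.sqrt_mul (by positivity),
        Real.sqrt_sq hcp.le]
    have hsq := Real.sq_sqrt hdisc.le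
    have hsq0 := Real.sqrt_nonneg (Tfun l k ^ 2 - 4 * Dfun l k)
    rw [e3, mu1, ← mul_add, mul_left_comm, mul_div_mul_left _ _ hcp.ne']
    generalize Real.sqrt (Tfun l k ^ 2 - 4 * Dfun l k) = r at *
    have : Tfun l k + r ≠ 0 := by linarith
    congr 1
    rw [div_eq_div_iff this two_ne_zero]
    linarith
  · rw [mul_zero, zero_mul, sub_zero, Real.sqrt_sq (by linarith)]
    linarith

lemma nhdsWithin_one_le : 𝓝[Ioo (0 : ℝ) 1] 1 ≤ 𝓝[≠] 1 :=
  nhdsWithin_mono _ fun _ hx => hx.2.ne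

lemma tendsto_Rsq_one : Tendsto Rsq (𝓝[Ioo 0 1] 1) (𝓝 1) := by
  have h1 : Tendsto (slope Real.log 1) (𝓝[Ioo 0 1] 1) (𝓝 1) := by
    simpa using (Real.hasDerivAt_log one_ne_zero).tendsto_slope.mono_left nhdsWithin_one_le
  have h2 : Tendsto (fun l : ℝ => (1 + l) / 2) (𝓝[Ioo 0 1] 1) (𝓝 ((1 + 1) / 2)) :=
    ((by fun_prop : Continuous fun l : ℝ => (1 + l) / 2).tendsto 1).mono_left nhdsWithin_le_nhds
  have h := h2.div h1 one_ne_zero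
  rw [show ((1 : ℝ) + 1) / 2 / 1 = 1 by norm_num] at h
  refine h.congr' ?_
  filter_upwards [self_mem_nhdsWithin] with l hl
  have : l - 1 ≠ 0 := by linarith [hl.2]
  have hlog : Real.log l ≠ 0 := by linarith [neg_log_pos hl]
  simp only [Pi.div_apply, slope_def_field, Real.log_one, sub_zero]
  rw [Rsq]
  field_simp
  ring

lemma tendsto_mu1_one {k : ℝ} (hk : 1 < k) :
    Tendsto (fun l => mu1 l k) (𝓝[Ioo 0 1] 1) (𝓝 (-2)) := by
  have hk0 : 0 < k := by linarith
  have hR := tendsto_Rsq_one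
  have hl2 : Tendsto (fun l : ℝ => l ^ 2) (𝓝[Ioo 0 1] 1) (𝓝 1) := by
    simpa using ((continuous_pow 2).tendsto (1 : ℝ)).mono_left nhdsWithin_le_nhds
  have hom : Tendsto (fun l => om l k) (𝓝[Ioo 0 1] 1) (𝓝[≠] 0) := by
    refine tendsto_nhdsWithin_iff.2 ⟨?_, ?_⟩
    · have : ContinuousAt (fun l => om l k) 1 := by
        unfold om; fun_prop (disch := norm_num)
      simpa [om] using this.tendsto.mono_left nhdsWithin_le_nhds
    · filter_upwards [self_mem_nhdsWithin] with l hl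
      rw [om_eq]
      exact (mul_pos hk0 (neg_log_pos hl)).ne'
  have hcoth : Tendsto (fun l => om l k * cothR (om l k)) (𝓝[Ioo 0 1] 1) (𝓝 1) :=
    tendsto_self_mul_cothR_zero.comp hom
  have hRl := hR.div hl2 one_ne_zero
  have hT : Tendsto (fun l => Tfun l k) (𝓝[Ioo 0 1] 1) (𝓝 2) := by
    have h := (((((hR.mul hRl).mul hcoth).const_mul 2).add_const 2).sub hR).sub hRl
    rw [show (2 : ℝ) * (1 * (1 / 1) * 1) + 2 - 1 - 1 / 1 = 2 by norm_num] at h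
    refine h.congr' ?_
    filter_upwards [self_mem_nhdsWithin] with l hl
    have hlog : Real.log l ≠ 0 := by linarith [neg_log_pos hl]
    have hl0 := hl.1.ne'
    have e : 1 - l ^ 2 = Rsq l * (-2 * Real.log l) := by
      rw [Rsq, div_mul_cancel₀ _ (mul_ne_zero (by norm_num) hlog)]
    have e2 : 1 / l ^ 2 - 1 = Rsq l * (-2 * Real.log l) / l ^ 2 := by
      rw [← e]; field_simp
    rw [Tfun, e2]
    simp only [Pi.div_apply]
    generalize cothR (om l k) = c
    rw [om]
    ring
  have hD : Tendsto (fun l => Dfun l k) (𝓝[Ioo 0 1] 1) (𝓝 0) := by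
    have h := ((hRl.sub_const 1).mul (hR.const_sub 1)).mul_const (k ^ 2 - 1)
    rw [show ((1 : ℝ) / 1 - 1) * (1 - 1) * (k ^ 2 - 1) = 0 by ring] at h
    exact h
  have h := ((hT.sub ((hT.pow 2).sub (hD.const_mul 4)).sqrt).div_const 2).sub_const 2
  have e : ((2 : ℝ) - Real.sqrt (2 ^ 2 - 4 * 0)) / 2 - 2 = -2 := by
    rw [mul_zero, sub_zero, Real.sqrt_sq two_pos.le]; norm_num
  rw [e] at h
  exact h

lemma tendsto_Tfun_div {l : ℝ} (hl : l ∈ Ioo (0 : ℝ) 1) :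
    Tendsto (fun k => Tfun l k / k) atTop (𝓝 ((Rsq l / l ^ 2 - 1) + (1 - Rsq l))) := by
  have hcoth : Tendsto (fun k => cothR (om l k)) atTop (𝓝 1) := by
    refine tendsto_cothR_atTop.comp ((tendsto_id.atTop_mul_const (neg_log_pos hl)).congr fun k => ?_)
    rw [om_eq, id]
  have h := (hcoth.const_mul (Rsq l * (1 / l ^ 2 - 1))).add
    ((tendsto_const_nhds (x := 2 - Rsq l - Rsq l / l ^ 2)).div_atTop tendsto_id)
  rw [show Rsq l * (1 / l ^ 2 - 1) * 1 + 0 = (Rsq l / l ^ 2 - 1) + (1 - Rsq l) by ring] at h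
  refine h.congr' ?_
  filter_upwards [eventually_gt_atTop 0] with k hk
  rw [Tfun, id]
  field_simp
  ring

lemma tendsto_Dfun_div_sq (l : ℝ) :
    Tendsto (fun k => Dfun l k / k ^ 2) atTop (𝓝 ((Rsq l / l ^ 2 - 1) * (1 - Rsq l))) := by
  have h := (((tendsto_pow_atTop (α := ℝ) two_ne_zero).inv_tendsto_atTop).const_sub 1).const_mul
    ((Rsq l / l ^ 2 - 1) * (1 - Rsq l))
  rw [sub_zero, mul_one] at h
  refine h.congr' ?_
  filter_upwards [eventually_gt_atTop 0] with k hk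
  simp only [Pi.inv_apply]
  rw [Dfun]
  field_simp

lemma tendsto_sqrt_discrim_div {l : ℝ} (hl : l ∈ Ioo (0 : ℝ) 1) :
    Tendsto (fun k => Real.sqrt (Tfun l k ^ 2 - 4 * Dfun l k) / k) atTop
      (𝓝 |(Rsq l / l ^ 2 - 1) - (1 - Rsq l)|) := by
  have h := (((tendsto_Tfun_div hl).pow 2).sub ((tendsto_Dfun_div_sq l).const_mul 4)).sqrt
  rw [show ((Rsq l / l ^ 2 - 1) + (1 - Rsq l)) ^ 2 - 4 * ((Rsq l / l ^ 2 - 1) * (1 - Rsq l)) =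
    ((Rsq l / l ^ 2 - 1) - (1 - Rsq l)) ^ 2 by ring, Real.sqrt_sq_eq_abs] at h
  refine h.congr' ?_
  filter_upwards [eventually_gt_atTop 0] with k hk
  rw [show (Tfun l k / k) ^ 2 - 4 * (Dfun l k / k ^ 2) =
    (Tfun l k ^ 2 - 4 * Dfun l k) / k ^ 2 by ring, Real.sqrt_div' _ (by positivity),
    Real.sqrt_sq hk.le]

lemma tendsto_mu1_div {l : ℝ} (hl : l ∈ Ioo (0 : ℝ) 1) :
    ∃ L : ℝ, 0 < L ∧ Tendsto (fun k => mu1 l k / k) atTop (𝓝 L) := by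
  have hA := sub_pos.2 (one_lt_Rsq_div_sq hl)
  have hB := sub_pos.2 (Rsq_lt_one hl)
  refine ⟨_, ?_, ((((tendsto_Tfun_div hl).sub (tendsto_sqrt_discrim_div hl)).div_const 2).sub
    (tendsto_const_nhds.div_atTop tendsto_id : Tendsto (fun k : ℝ => 2 / k) atTop (𝓝 0))).congr
    fun k => ?_⟩
  · have := abs_lt.2 (⟨by linarith, by linarith⟩ :
      -((Rsq l / l ^ 2 - 1) + (1 - Rsq l)) < (Rsq l / l ^ 2 - 1) - (1 - Rsq l) ∧
      (Rsq l / l ^ 2 - 1) - (1 - Rsq l) < (Rsq l / l ^ 2 - 1) + (1 - Rsq l))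
    linarith
  · rw [mu1]; ring

lemma tendsto_mu2_div {l : ℝ} (hl : l ∈ Ioo (0 : ℝ) 1) :
    ∃ L : ℝ, 0 < L ∧ Tendsto (fun k => mu2 l k / k) atTop (𝓝 L) := by
  have hA := sub_pos.2 (one_lt_Rsq_div_sq hl)
  have hB := sub_pos.2 (Rsq_lt_one hl)
  refine ⟨_, ?_, ((((tendsto_Tfun_div hl).add (tendsto_sqrt_discrim_div hl)).div_const 2).sub
    (tendsto_const_nhds.div_atTop tendsto_id : Tendsto (fun k : ℝ => 2 / k) atTop (𝓝 0))).congr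
    fun k => ?_⟩
  · rw [sub_zero]; positivity
  · rw [mu2]; ring

lemma mu_one {l : ℝ} (hl : l ∈ Ioo (0 : ℝ) 1) : mu1 l 1 = -2 ∧ mu2 l 1 = 0 := by
  have hT : Tfun l 1 = 2 := by
    rw [Tfun_eq hl, one_mul, one_mul, sub_self, mul_zero, zero_add]
  have hD : Dfun l 1 = 0 := by unfold Dfun; ring
  have hs : Real.sqrt ((2 : ℝ) ^ 2 - 4 * 0) = 2 := by
    rw [mul_zero, sub_zero, Real.sqrt_sq two_pos.le]
  rw [mu1, mu2, hT, hD, hs]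
  norm_num

/-- Once `μ₁(·, k)` is nonpositive it stays negative. -/
lemma mu1_neg_of_lt {k a b : ℝ} (hk : 1 < k) (ha : 0 < a) (hb : b < 1) (hab : a < b)
    (h : mu1 a k ≤ 0) : mu1 b k < 0 :=
  neg_of_deriv_neg_at_zeros (f := fun l => mu1 l k) hab
    (fun _ hx => differentiableAt_mu1 ⟨ha.trans_le hx.1, hx.2.trans_lt hb⟩ (by linarith))
    (fun _ hx h0 => deriv_mu1_neg ⟨ha.trans_le hx.1, hx.2.trans_lt hb⟩ hk h0) h

lemma exists_mu1_eq_zero {k : ℝ} (hk : 1 < k) : ∃ l ∈ Ioo (0 : ℝ) 1, mu1 l k = 0 := by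
  have : (𝓝[Ioo (0 : ℝ) 1] 0).NeBot := left_nhdsWithin_Ioo_neBot one_pos
  have : (𝓝[Ioo (0 : ℝ) 1] 1).NeBot := right_nhdsWithin_Ioo_neBot one_pos
  obtain ⟨a, ha0, ha⟩ := (((tendsto_mu1_zero hk).eventually
    (lt_mem_nhds (sub_pos.2 hk))).and self_mem_nhdsWithin).exists
  obtain ⟨b, hb0, hb⟩ := (((tendsto_mu1_one hk).eventually
    (gt_mem_nhds (neg_lt_zero.2 two_pos))).and self_mem_nhdsWithin).exists
  exact isPreconnected_Ioo.intermediate_value hb ha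
    (f := fun l => mu1 l k) (fun l hl =>
      (differentiableAt_mu1 hl (by linarith)).continuousAt.continuousWithinAt) ⟨hb0.le, ha0.le⟩

/-- the qualitative properties of the eigenvalues `μ₁, μ₂`:
(i) `μ₁(λ,1) = -2`, `μ₂(λ,1) = 0`; (ii) `μ₂(λ,k) > 0` for integers `k ≥ 2`;
(iii) for integers `k ≥ 2`, `μ₁(λ,k) → k - 1` as `λ → 0⁺`, `μ₁(λ,k) → -2` as `λ → 1⁻`,
and there is a unique `λ_k ∈ (0,1)` with `μ₁(λ_k,k) = 0`, at which `∂μ₁/∂λ < 0`;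
(iv) `(λ_k)_{k ≥ 2}` is strictly increasing and converges to `1`;
(v) `μ_i(λ,k)/k` has a finite positive limit as `k → ∞`, with
`T(λ,k)/k → R²(1-λ²)/λ²` and `D/T² → λ²(R²-λ²)(1-R²)/(R⁴(1-λ²)²)`. -/
theorem eigenvalue_properties :
    (∀ l ∈ Ioo (0:ℝ) 1, mu1 l 1 = -2 ∧ mu2 l 1 = 0) ∧
    (∀ l ∈ Ioo (0:ℝ) 1, ∀ k : ℕ, 2 ≤ k → 0 < mu2 l (k:ℝ)) ∧
    (∀ k : ℕ, 2 ≤ k →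
      Tendsto (fun l => mu1 l (k:ℝ)) (nhdsWithin 0 (Ioo (0:ℝ) 1)) (nhds ((k:ℝ) - 1)) ∧
      Tendsto (fun l => mu1 l (k:ℝ)) (nhdsWithin 1 (Ioo (0:ℝ) 1)) (nhds (-2))) ∧
    (∃ lam : ℕ → ℝ,
      (∀ k : ℕ, 2 ≤ k →
        lam k ∈ Ioo (0:ℝ) 1 ∧ mu1 (lam k) (k:ℝ) = 0 ∧
        (∀ l ∈ Ioo (0:ℝ) 1, mu1 l (k:ℝ) = 0 → l = lam k) ∧
        deriv (fun l => mu1 l (k:ℝ)) (lam k) < 0) ∧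
      StrictMonoOn lam {k : ℕ | 2 ≤ k} ∧
      Tendsto lam atTop (nhds 1)) ∧
    (∀ l ∈ Ioo (0:ℝ) 1,
      (∃ L₁ : ℝ, 0 < L₁ ∧ Tendsto (fun k : ℝ => mu1 l k / k) atTop (nhds L₁)) ∧
      (∃ L₂ : ℝ, 0 < L₂ ∧ Tendsto (fun k : ℝ => mu2 l k / k) atTop (nhds L₂)) ∧
      Tendsto (fun k : ℝ => Tfun l k / k) atTop (nhds (Rsq l * (1 - l^2)/l^2)) ∧
      Tendsto (fun k : ℝ => Dfun l k / (Tfun l k)^2) atTop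
        (nhds (l^2*(Rsq l - l^2)*(1 - Rsq l)/((Rsq l)^2*(1 - l^2)^2)))) := by
  have hk1 : ∀ k : ℕ, 2 ≤ k → (1 : ℝ) < k := fun k hk => by exact_mod_cast hk
  have hex : ∀ k : ℕ, ∃ l : ℝ, 2 ≤ k → l ∈ Ioo (0 : ℝ) 1 ∧ mu1 l k = 0 := fun k => by
    by_cases hk : 2 ≤ k
    · obtain ⟨l, hl, h⟩ := exists_mu1_eq_zero (hk1 k hk)
      exact ⟨l, fun _ => ⟨hl, h⟩⟩
    · exact ⟨0, fun h => absurd h hk⟩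
  choose lam hlam using hex
  have hlt : ∀ k : ℕ, 2 ≤ k → ∀ l ∈ Ioo (0 : ℝ) 1, 0 < mu1 l k → l < lam k := by
    intro k hk l hl hpos
    obtain ⟨hm, hz⟩ := hlam k hk
    by_contra! hle
    rcases hle.eq_or_lt with rfl | hlt
    · exact hpos.ne' hz
    · exact lt_asymm hpos (mu1_neg_of_lt (hk1 k hk) hm.1 hl.2 hlt hz.le)
  refine ⟨fun l hl => mu_one hl, fun l hl k hk => mu2_pos hl (hk1 k hk),
    fun k hk => ⟨tendsto_mu1_zero (hk1 k hk), tendsto_mu1_one (hk1 k hk)⟩,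
    ⟨lam, fun k hk => ⟨(hlam k hk).1, (hlam k hk).2, fun l hl h0 => ?_,
      deriv_mu1_neg (hlam k hk).1 (hk1 k hk) (hlam k hk).2⟩, ?_, ?_⟩, fun l hl =>
    ⟨tendsto_mu1_div hl, tendsto_mu2_div hl, ?_, ?_⟩⟩
  · obtain ⟨hm, hz⟩ := hlam k hk
    rcases lt_trichotomy l (lam k) with h | h | h
    · exact absurd hz (mu1_neg_of_lt (hk1 k hk) hl.1 hm.2 h h0.le).ne
    · exact h
    · exact absurd h0 (mu1_neg_of_lt (hk1 k hk) hm.1 hl.2 h hz.le).ne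
  · intro j hj k hk hjk
    obtain ⟨hm, hz⟩ := hlam j hj
    refine hlt k hk _ hm ((mu1_pos_iff hm (hk1 k hk)).2 ?_)
    exact gfun_pos_of_lt (hk1 j hj) (Nat.cast_lt.2 hjk) (neg_log_pos hm)
      ((mu1_eq_zero_iff hm (hk1 j hj)).1 hz)
  · refine tendsto_order.2 ⟨fun a ha => ?_, fun b hb => ?_⟩
    · have hl : max a (1 / 2) ∈ Ioo (0 : ℝ) 1 :=
        ⟨lt_max_of_lt_right (by norm_num), max_lt ha (by norm_num)⟩
      obtain ⟨L, hL, hlim⟩ := tendsto_mu1_div hl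
      have hev := (hlim.comp tendsto_natCast_atTop_atTop).eventually (lt_mem_nhds hL)
      filter_upwards [hev, eventually_ge_atTop 2] with k hpos hk
      have hk0 : (0 : ℝ) < k := one_pos.trans (hk1 k hk)
      exact (le_max_left _ _).trans_lt (hlt k hk _ hl ((div_pos_iff_of_pos_right hk0).1 hpos))
    · filter_upwards [eventually_ge_atTop 2] with k hk
      exact (hlam k hk).1.2.trans hb
  · have h := tendsto_Tfun_div hl
    rwa [show (Rsq l / l ^ 2 - 1) + (1 - Rsq l) = Rsq l * (1 - l ^ 2) / l ^ 2 by
      have := hl.1.ne'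
      field_simp
      ring] at h
  · have hA := sub_pos.2 (one_lt_Rsq_div_sq hl)
    have hB := sub_pos.2 (Rsq_lt_one hl)
    have h := (tendsto_Dfun_div_sq l).div ((tendsto_Tfun_div hl).pow 2) (by positivity)
    have hl0 := hl.1.ne'
    have hR := (Rsq_pos hl).ne'
    have hl1 : 1 - l ^ 2 ≠ 0 := by nlinarith [hl.1, hl.2]
    have e : (Rsq l / l ^ 2 - 1) * (1 - Rsq l) / ((Rsq l / l ^ 2 - 1) + (1 - Rsq l)) ^ 2 =
        l^2*(Rsq l - l^2)*(1 - Rsq l)/((Rsq l)^2*(1 - l^2)^2) := by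
      rw [show (Rsq l / l ^ 2 - 1) + (1 - Rsq l) = Rsq l * (1 - l ^ 2) / l ^ 2 by
        field_simp
        ring]
      field_simp
    rw [e] at h
    refine h.congr' ?_
    filter_upwards [eventually_gt_atTop 0] with k hk
    simp only [Pi.div_apply]
    field_simp
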